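/- Fix a positive rational number γ and let z_γ ∈ (0,1) be the unique solution of l_γ'(z) = 0. Then, as d → ∞ along positive integers d such that γd is an integer, log( N₁(d,γ) − N₂(d,γ) ) − [ d · l_γ(z_γ) − (1/2) log d − log( h(z_γ) z_γ (1 − z_γ) (2 l_γ''(z_γ) π)^{1/2} / (h(z_γ) − 1) ) ] → 0. -/

import Mathlib

open Real Set Filter

/-- The Jacobi theta function `h(z) = Σ_{r ∈ ℤ} z^{r²}` for real `0 < z < 1`. -/
noncomputable def jacobiH (z : ℝ) : ℝ := ∑' r : ℤ, z ^ (r ^ 2).toNat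

/-- `l_γ(z) = log h(z) − γ log z`. -/
noncomputable def lgam (γ : ℝ) (z : ℝ) : ℝ := Real.log (jacobiH z) - γ * Real.log z

/-- `N₁(d,γ) = #{k ∈ ℤ^d : k₁² + … + k_d² ≤ γ d}`. -/
noncomputable def N1 (d : ℕ) (γ : ℝ) : ℕ :=
  Set.ncard {k : Fin d → ℤ | (∑ i, ((k i : ℝ)) ^ 2) ≤ γ * d}

/-- The filter of `d → ∞` along positive integers `d` such that `γ d` is an integer. -/
def alongIntMultiples (γ : ℚ) : Filter ℕ :=
  Filter.atTop ⊓ Filter.principal {d : ℕ | ∃ m : ℤ, (γ : ℝ) * d = (m : ℝ)}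

/-- `N₂(d,γ) = #{k ∈ ℤ^d : k₁ = 0 and k₂² + … + k_d² ≤ γ d}` (the first coordinate,
i.e. the coordinate of index `0`, vanishes). -/
noncomputable def N2 (d : ℕ) (γ : ℝ) : ℕ :=
  Set.ncard {k : Fin d → ℤ |
    (∀ i : Fin d, (i : ℕ) = 0 → k i = 0) ∧ (∑ i, ((k i : ℝ)) ^ 2) ≤ γ * d}

section LocalLimit

open MeasureTheory ProbabilityTheory Topology

variable {Ω : Type*} {mΩ : MeasurableSpace Ω} {P : Measure Ω} [IsProbabilityMeasure P] {Y : Ω → ℝ}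

/-- Pointwise convergence of rescaled powers of a characteristic function, for a centred
variable of arbitrary positive variance `v`. -/
lemma tendsto_charFun_pow_of_variance {v : ℝ} (hv : 0 < v) (hY : AEMeasurable Y P)
    (h0 : ∫ ω, Y ω ∂P = 0) (h2 : ∫ ω, Y ω ^ 2 ∂P = v) (t : ℝ) :
    Tendsto (fun n : ℕ => charFun (P.map Y) ((√n)⁻¹ * t) ^ n) atTop
      (𝓝 (rexp (-(v / 2) * t ^ 2) : ℂ)) := by
  have hs : 0 < √v := Real.sqrt_pos.2 hv
  have key := tendsto_charFun_inv_sqrt_mul_pow (P := P) (X := fun ω => (√v)⁻¹ * Y ω)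
    (by fun_prop) (by simp [integral_const_mul, h0])
    (by
      simp only [Pi.pow_def, mul_pow, integral_const_mul, h2]
      rw [inv_pow, Real.sq_sqrt hv.le, inv_mul_cancel₀ hv.ne']) (√v * t)
  have hl : (rexp (-(v / 2) * t ^ 2) : ℂ) = Complex.exp (-((√v * t : ℝ) : ℂ) ^ 2 / 2) := by
    rw [← Complex.ofReal_pow, mul_pow, Real.sq_sqrt hv.le]
    push_cast
    ring_nf
  rw [hl]
  refine key.congr fun n => ?_
  rw [charFun_map_mul_comp hY]
  congr 2
  field_simp

/-- A local limit theorem: an oscillatory integral against the powers of a characteristic function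
with Gaussian decay concentrates at the origin. -/
lemma tendsto_sqrt_mul_integral_charFun_pow {v c : ℝ} (hv : 0 < v) (hc : 0 < c)
    (hY : AEMeasurable Y P)
    (h0 : ∫ ω, Y ω ∂P = 0) (h2 : ∫ ω, Y ω ^ 2 ∂P = v)
    (hdecay : ∀ θ ∈ Icc (-π) π, ‖charFun (P.map Y) θ‖ ≤ rexp (-c * θ ^ 2))
    {ψ : ℝ → ℂ} (hψ : Continuous ψ) :
    Tendsto (fun n : ℕ => (√n : ℂ) * ∫ θ in (-π)..π, ψ θ * charFun (P.map Y) θ ^ n) atTop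
      (𝓝 (ψ 0 * √(2 * π / v))) := by
  have := Measure.isProbabilityMeasure_map (μ := P) hY
  obtain ⟨M, hM⟩ := (isCompact_Icc (a := -π) (b := π)).exists_bound_of_continuousOn
    hψ.continuousOn
  set φ := charFun (P.map Y) with hφ
  have hφc : Continuous φ := continuous_charFun
  let F : ℕ → ℝ → ℂ := fun n => (Ioc (-(π * √n)) (π * √n)).indicator
    fun t => ψ ((√n)⁻¹ * t) * φ ((√n)⁻¹ * t) ^ n
  have hlim : Tendsto (fun n => ∫ t, F n t) atTop
      (𝓝 (∫ t : ℝ, ψ 0 * (rexp (-(v / 2) * t ^ 2) : ℂ))) := by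
    refine tendsto_integral_of_dominated_convergence (fun t => M * rexp (-c * t ^ 2)) ?_
      ((integrable_exp_neg_mul_sq hc).const_mul M) ?_ ?_
    · intro n
      exact (Continuous.aestronglyMeasurable (by fun_prop)).indicator measurableSet_Ioc
    · intro n
      refine Eventually.of_forall fun t => ?_
      have hM0 : 0 ≤ M := (norm_nonneg _).trans (hM 0 ⟨by linarith [pi_pos], pi_pos.le⟩)
      by_cases ht : t ∈ Ioc (-(π * √n)) (π * √n)
      · have hn : 0 < √(n : ℝ) := by
          by_contra hn
          have : √(n : ℝ) = 0 := le_antisymm (not_lt.1 hn) (Real.sqrt_nonneg _)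
          simp [this] at ht
        have hmem : (√n)⁻¹ * t ∈ Icc (-π) π := by
          rw [inv_mul_eq_div]
          constructor
          · rw [le_div_iff₀ hn]; linarith [ht.1]
          · rw [div_le_iff₀ hn]; exact ht.2
        simp only [F, indicator_of_mem ht, norm_mul, norm_pow]
        refine mul_le_mul (hM _ hmem) ?_ (by positivity) hM0
        refine (pow_le_pow_left₀ (norm_nonneg _) (hdecay _ hmem) n).trans (le_of_eq ?_)
        rw [← Real.exp_nat_mul]
        congr 1
        rw [mul_pow, inv_pow, Real.sq_sqrt (Nat.cast_nonneg n)]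
        have : (n : ℝ) ≠ 0 := by
          have := Real.sqrt_pos.1 hn
          exact this.ne'
        field_simp
      · simp only [F, indicator_of_notMem ht, norm_zero]
        positivity
    · refine Eventually.of_forall fun t => ?_
      have hsq : Tendsto (fun n : ℕ => √(n : ℝ)) atTop atTop :=
        Real.tendsto_sqrt_atTop.comp tendsto_natCast_atTop_atTop
      have harg : Tendsto (fun n : ℕ => (√(n : ℝ))⁻¹ * t) atTop (𝓝 0) := by
        simpa using (tendsto_inv_atTop_zero.comp hsq).mul_const t
      have hmain := ((hψ.tendsto 0).comp harg).mul
        (tendsto_charFun_pow_of_variance hv hY h0 h2 t)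
      refine hmain.congr' ?_
      filter_upwards [(hsq.const_mul_atTop pi_pos).eventually_gt_atTop |t|] with n hn
      have ht : t ∈ Ioc (-(π * √(n : ℝ))) (π * √n) :=
        ⟨(abs_lt.1 hn).1, (abs_lt.1 hn).2.le⟩
      simp only [F, indicator_of_mem ht, Function.comp, hφ]
  have hval : ∫ t : ℝ, ψ 0 * (rexp (-(v / 2) * t ^ 2) : ℂ) = ψ 0 * √(2 * π / v) := by
    rw [integral_const_mul, integral_complex_ofReal, integral_gaussian]
    congr 3
    field_simp
  rw [hval] at hlim
  refine hlim.congr' ?_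
  filter_upwards [eventually_gt_atTop 0] with n hn
  have hs : 0 < √(n : ℝ) := Real.sqrt_pos.2 (by exact_mod_cast hn)
  simp only [F]
  rw [integral_indicator measurableSet_Ioc,
    ← intervalIntegral.integral_of_le (by nlinarith [pi_pos]),
    intervalIntegral.integral_comp_mul_left (fun θ => ψ θ * φ θ ^ n) (inv_ne_zero hs.ne')]
  rw [inv_inv, mul_neg, show (√(n : ℝ))⁻¹ * (π * √n) = π by field_simp, Complex.real_smul]

end LocalLimit

lemma hasSum_mul_of_summable_norm {α β 𝕜 : Type*} [NormedField 𝕜] [CompleteSpace 𝕜] {f : α → 𝕜}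
    {g : β → 𝕜} {s t : 𝕜} (hf : HasSum f s) (hg : HasSum g t)
    (hfn : Summable fun a => ‖f a‖) (hgn : Summable fun b => ‖g b‖) :
    HasSum (fun x : α × β => f x.1 * g x.2) (s * t) := by
  have h := summable_mul_of_summable_norm hfn hgn
  exact hf.mul hg h

/-- Powers of an absolutely convergent sum expand as sums over tuples. -/
lemma hasSum_prod_fin {α 𝕜 : Type*} [NormedField 𝕜] [CompleteSpace 𝕜] {f : α → 𝕜} {s : 𝕜}
    (hf : HasSum f s) (hn : Summable fun a => ‖f a‖) (n : ℕ) :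
    (Summable fun k : Fin n → α => ‖∏ i, f (k i)‖) ∧
      HasSum (fun k : Fin n → α => ∏ i, f (k i)) (s ^ n) := by
  induction n with
  | zero => exact ⟨(hasSum_fintype _).summable, by simp⟩
  | succ n ih =>
    have hsum := hn.mul_norm ih.1
    refine ⟨?_, ?_⟩
    · rw [← (Fin.consEquiv fun _ : Fin (n + 1) => α).summable_iff]
      refine hsum.congr fun x => ?_
      simp [Fin.consEquiv, Fin.prod_univ_succ]
    · rw [← (Fin.consEquiv fun _ : Fin (n + 1) => α).hasSum_iff, pow_succ']
      have hcons : (fun k : Fin (n + 1) → α => ∏ i, f (k i)) ∘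
          (Fin.consEquiv fun _ : Fin (n + 1) => α) = fun x => f x.1 * ∏ i, f (x.2 i) := by
        funext x
        simp [Fin.consEquiv, Fin.prod_univ_succ]
      rw [hcons]
      have hmul := hasSum_mul_of_summable_norm hf ih.2 hn ih.1
      exact hmul

/-- Coefficient extraction by integration over a circle. -/
lemma integral_tsum_pow_mul_exp {ι : Type*} [Countable ι] (e : ι → ℕ) {ρ : ℝ} (hρ : 0 < ρ)
    (hs : Summable fun i => ρ ^ e i) (m : ℕ) :
    ∫ θ in (-π)..π, (∑' i, (ρ * Complex.exp (θ * Complex.I)) ^ e i) *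
        Complex.exp (-(m * θ * Complex.I)) =
      2 * π * ρ ^ m * ({i | e i = m}.ncard : ℂ) := by
  let F : ι → ℝ → ℂ := fun i θ =>
    (ρ * Complex.exp (θ * Complex.I)) ^ e i * Complex.exp (-(m * θ * Complex.I))
  have hF : ∀ i θ, F i θ = (ρ : ℂ) ^ e i * Complex.exp (((e i : ℂ) - m) * Complex.I * θ) := by
    intro i θ
    simp only [F, mul_pow, ← Complex.exp_nat_mul, mul_assoc, ← Complex.exp_add]
    ring_nf
  have hnorm : ∀ i θ, ‖F i θ‖ = ρ ^ e i := by
    intro i θ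
    have : ((e i : ℂ) - m) * Complex.I * θ = ((((e i : ℝ) - m) * θ : ℝ) : ℂ) * Complex.I := by
      push_cast; ring
    rw [hF, norm_mul, this, Complex.norm_exp_ofReal_mul_I]
    simp [abs_of_pos hρ]
  have hint : ∀ i, ∫ θ in (-π)..π, F i θ = {i | e i = m}.indicator (fun _ => 2 * π * (ρ : ℂ) ^ m) i := by
    intro i
    simp_rw [hF]
    rw [intervalIntegral.integral_const_mul]
    by_cases h : e i = m
    · simp [h]
      ring
    · have hne : ((e i : ℂ) - m) * Complex.I ≠ 0 :=
        mul_ne_zero (sub_ne_zero.2 (by exact_mod_cast h)) Complex.I_ne_zero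
      rw [integral_exp_mul_complex hne, indicator_of_notMem (by simpa using h)]
      have hper : Complex.exp (((e i : ℂ) - m) * Complex.I * (π : ℝ)) =
          Complex.exp (((e i : ℂ) - m) * Complex.I * ((-π : ℝ) : ℝ)) := by
        rw [Complex.exp_eq_exp_iff_exists_int]
        exact ⟨(e i : ℤ) - m, by push_cast; ring⟩
      rw [hper]; simp
  have hsum : HasSum (fun i => ∫ θ in (-π)..π, F i θ) (∫ θ in (-π)..π, ∑' i, F i θ) := by
    simp_rw [intervalIntegral.integral_of_le (show -π ≤ π by linarith [pi_pos])]
    refine MeasureTheory.hasSum_integral_of_summable_integral_norm ?_ ?_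
    · intro i
      have : Continuous (F i) := by fun_prop
      exact (this.integrableOn_Icc).mono_set Ioc_subset_Icc_self
    · simp only [hnorm]
      simpa using (hs.mul_left _)
  simp_rw [← tsum_mul_right]
  rw [← hsum.tsum_eq]
  simp_rw [hint]
  rw [← tsum_subtype, tsum_const, Nat.card_coe_set_eq]
  simp [mul_comm]

lemma toNat_sq_cast (r : ℤ) : (((r ^ 2).toNat : ℕ) : ℝ) = (r : ℝ) ^ 2 := by
  have : (((r ^ 2).toNat : ℕ) : ℤ) = r ^ 2 := Int.toNat_of_nonneg (sq_nonneg r)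
  exact_mod_cast this

lemma summable_pow_toNat_sq {ρ : ℝ} (h0 : 0 ≤ ρ) (h1 : ρ < 1) :
    Summable fun r : ℤ => ρ ^ (r ^ 2).toNat := by
  have hg : Summable fun n : ℕ => ρ ^ (((n : ℤ) ^ 2).toNat) := by
    refine (summable_geometric_of_lt_one h0 h1).of_nonneg_of_le (fun _ => by positivity) fun n => ?_
    refine pow_le_pow_of_le_one h0 h1.le ?_
    have : (((n : ℤ) ^ 2).toNat) = n ^ 2 := by
      rw [← Nat.cast_pow, Int.toNat_natCast]
    rw [this]
    exact Nat.le_self_pow two_ne_zero n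
  exact Summable.of_nat_of_neg hg (by simpa using hg)

/-- The theta function on the complex unit disc. -/
noncomputable def thetaC (w : ℂ) : ℂ := ∑' r : ℤ, w ^ (r ^ 2).toNat

lemma hasSum_thetaC {w : ℂ} (hw : ‖w‖ < 1) :
    HasSum (fun r : ℤ => w ^ (r ^ 2).toNat) (thetaC w) :=
  (Summable.of_norm (by simpa using summable_pow_toNat_sq (norm_nonneg w) hw)).hasSum

/-- The degree of the monomial that `(r, k, j)` contributes to the generating function of
`N₁ - N₂`. -/
def latticeDegree (n : ℕ) (x : {r : ℤ // r ≠ 0} × (Fin n → ℤ) × ℕ) : ℕ :=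
  ((x.1 : ℤ) ^ 2).toNat + ((∑ i, ((x.2.1 i) ^ 2).toNat) + x.2.2)

lemma hasSum_pow_latticeDegree {w : ℂ} (hw : ‖w‖ < 1) (n : ℕ) :
    (Summable fun x => ‖w‖ ^ latticeDegree n x) ∧
      HasSum (fun x => w ^ latticeDegree n x) ((thetaC w - 1) * (thetaC w ^ n * (1 - w)⁻¹)) := by
  have hN : Summable fun r : ℤ => ‖w ^ (r ^ 2).toNat‖ := by
    simpa using summable_pow_toNat_sq (norm_nonneg w) hw
  have hpi := hasSum_prod_fin (hasSum_thetaC hw) hN n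
  have hgeom := hasSum_geometric_of_norm_lt_one hw
  have hgeomN : Summable fun j : ℕ => ‖w ^ j‖ := by
    simpa using summable_geometric_of_lt_one (norm_nonneg w) hw
  have hne : HasSum (fun r : {r : ℤ // r ≠ 0} => w ^ ((r : ℤ) ^ 2).toNat) (thetaC w - 1) := by
    have h0 := hasSum_unique (fun r : ({0} : Set ℤ) => w ^ ((r : ℤ) ^ 2).toNat)
    have := (HasSum.hasSum_compl_iff (f := fun r : ℤ => w ^ (r ^ 2).toNat) (s := {0})
      (a₁ := 1) (a₂ := thetaC w - 1) (by simpa [Function.comp_def] using h0)).2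
      (by simpa using hasSum_thetaC hw)
    exact this
  have hneN : Summable fun r : {r : ℤ // r ≠ 0} => ‖w ^ ((r : ℤ) ^ 2).toNat‖ :=
    hN.comp_injective Subtype.val_injective
  have h2N := hpi.1.mul_norm hgeomN
  have h3N := hneN.mul_norm h2N
  have hform : ∀ x, w ^ latticeDegree n x =
      w ^ ((x.1 : ℤ) ^ 2).toNat * ((∏ i, w ^ ((x.2.1 i) ^ 2).toNat) * w ^ x.2.2) := by
    intro x
    rw [latticeDegree, pow_add, pow_add, Finset.prod_pow_eq_pow_sum]
  refine ⟨h3N.congr fun x => by rw [← norm_pow, hform], ?_⟩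
  rw [funext hform]
  have h2 := hasSum_mul_of_summable_norm hpi.2 hgeom hpi.1 hgeomN
  have h3 := hasSum_mul_of_summable_norm hne h2 hneN h2N
  exact h3

lemma finite_sum_sq_le (d : ℕ) (c : ℝ) :
    {k : Fin d → ℤ | (∑ i, ((k i : ℝ)) ^ 2) ≤ c}.Finite := by
  have hfin : (Set.pi univ fun _ : Fin d => Icc (-⌈c⌉) ⌈c⌉).Finite :=
    Set.Finite.pi fun _ => finite_Icc _ _
  refine hfin.subset fun k hk i _ => ?_
  have h1 : ((k i : ℝ)) ^ 2 ≤ ⌈c⌉ :=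
    ((Finset.single_le_sum (f := fun i => ((k i : ℝ)) ^ 2) (fun _ _ => sq_nonneg _)
      (Finset.mem_univ i)).trans hk).trans (Int.le_ceil c)
  have h2 : (k i) ^ 2 ≤ ⌈c⌉ := by exact_mod_cast h1
  constructor <;> nlinarith

lemma N1_sub_N2_eq_ncard (n m : ℕ) (γ : ℝ) (h : γ * ((n + 1 : ℕ) : ℝ) = m) :
    (N1 (n + 1) γ : ℝ) - N2 (n + 1) γ = ({x | latticeDegree n x = m}.ncard : ℝ) := by
  set A : Set (Fin (n + 1) → ℤ) := {k | (∑ i, ((k i : ℝ)) ^ 2) ≤ γ * (n + 1 : ℕ)}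
  set B : Set (Fin (n + 1) → ℤ) :=
    {k | (∀ i : Fin (n + 1), (i : ℕ) = 0 → k i = 0) ∧ (∑ i, ((k i : ℝ)) ^ 2) ≤ γ * (n + 1 : ℕ)}
  have hBA : B ⊆ A := fun k hk => hk.2
  have hA : A.Finite := finite_sum_sq_le _ _
  have hdiff : (N1 (n + 1) γ : ℝ) - N2 (n + 1) γ = ((A \ B).ncard : ℝ) := by
    have := Set.ncard_sdiff_add_ncard_of_subset hBA hA
    change (A.ncard : ℝ) - B.ncard = _
    rw [← this]; push_cast; ring
  have himage : A \ B = (fun x : {r : ℤ // r ≠ 0} × (Fin n → ℤ) × ℕ =>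
      (Fin.cons (x.1 : ℤ) x.2.1 : Fin (n + 1) → ℤ)) '' {x | latticeDegree n x = m} := by
    have hcast : ∀ k : Fin (n + 1) → ℤ, k ∈ A ↔
        ((k 0) ^ 2).toNat + ∑ i : Fin n, ((k i.succ) ^ 2).toNat ≤ m := by
      intro k
      simp only [A, mem_ofPred_eq, h, ← toNat_sq_cast, Fin.sum_univ_succ]
      exact_mod_cast Iff.rfl
    have hB : ∀ k ∈ A, (k ∉ B ↔ k 0 ≠ 0) := by
      intro k hk
      refine not_congr ⟨fun hb => hb.1 0 rfl, fun h0 => ⟨fun i hi => ?_, hk⟩⟩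
      rwa [show i = 0 from Fin.ext hi]
    ext k
    constructor
    · rintro ⟨hkA, hkB⟩
      refine ⟨(⟨k 0, (hB k hkA).1 hkB⟩, Fin.tail k,
        m - (((k 0) ^ 2).toNat + ∑ i : Fin n, ((k i.succ) ^ 2).toNat)), ?_, ?_⟩
      · have := (hcast k).1 hkA
        simp only [latticeDegree, mem_ofPred_eq, Fin.tail]
        omega
      · simp
    · rintro ⟨⟨r, k', j⟩, hx, rfl⟩
      have hmem : (Fin.cons (r : ℤ) k' : Fin (n + 1) → ℤ) ∈ A := by
        rw [hcast]
        simp only [latticeDegree, mem_ofPred_eq] at hx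
        simp only [Fin.cons_zero, Fin.cons_succ]
        omega
      exact ⟨hmem, (hB _ hmem).2 (by simpa using r.2)⟩
  rw [hdiff, himage, Set.InjOn.ncard_image]
  rintro ⟨r, k, j⟩ hx ⟨r', k', j'⟩ hx' heq
  obtain ⟨h1, h2⟩ := Fin.cons_inj.1 heq
  obtain rfl : r = r' := Subtype.ext h1
  subst h2
  simp only [latticeDegree, mem_ofPred_eq] at hx hx'
  obtain rfl : j = j' := by omega
  rfl

lemma one_lt_jacobiH {z : ℝ} (hz : z ∈ Ioo (0 : ℝ) 1) : 1 < jacobiH z := by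
  have h := (summable_pow_toNat_sq hz.1.le hz.2).sum_le_tsum ({0, 1} : Finset ℤ)
    (fun r _ => pow_nonneg hz.1.le _)
  rw [Finset.sum_pair (by norm_num)] at h
  simp only [ne_eq, OfNat.ofNat_ne_zero, not_false_eq_true, zero_pow, Int.toNat_zero, pow_zero,
    one_pow, Int.toNat_one, pow_one] at h
  exact lt_of_lt_of_le (by linarith [hz.1]) h

lemma norm_one_add_mul_exp_le {ρ θ : ℝ} (hρ : 0 < ρ) (hθ : |θ| ≤ π) :
    ‖1 + (ρ : ℂ) * Complex.exp (θ * Complex.I)‖ ≤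
      1 + ρ - 2 * ρ / (π ^ 2 * (1 + ρ)) * θ ^ 2 := by
  have hcos := Real.cos_le_one_sub_mul_cos_sq hθ
  have hsq : ‖1 + (ρ : ℂ) * Complex.exp (θ * Complex.I)‖ ^ 2 =
      (1 + ρ) ^ 2 - 2 * ρ * (1 - Real.cos θ) := by
    rw [← Complex.normSq_eq_norm_sq, Complex.exp_mul_I, ← Complex.ofReal_cos,
      ← Complex.ofReal_sin, Complex.normSq_apply]
    simp only [Complex.add_re, Complex.add_im, Complex.mul_re, Complex.mul_im, Complex.ofReal_re,
      Complex.ofReal_im, Complex.I_re, Complex.I_im, Complex.one_re, Complex.one_im]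
    nlinarith [Real.sin_sq_add_cos_sq θ]
  have hu : 2 * ρ / (π ^ 2 * (1 + ρ)) * θ ^ 2 * (1 + ρ) = ρ * (2 / π ^ 2 * θ ^ 2) := by
    field_simp
  set u := 2 * ρ / (π ^ 2 * (1 + ρ)) * θ ^ 2
  have hx : 2 / π ^ 2 * θ ^ 2 ≤ 2 := by
    have : θ ^ 2 ≤ π ^ 2 := sq_le_sq' (abs_le.1 hθ).1 (abs_le.1 hθ).2
    rw [div_mul_eq_mul_div, div_le_iff₀ (by positivity)]
    linarith
  have hu0 : 0 ≤ 1 + ρ - u := by nlinarith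
  refine (sq_le_sq₀ (norm_nonneg _) hu0).1 ?_
  rw [hsq]
  nlinarith [mul_le_mul_of_nonneg_left hcos hρ.le, sq_nonneg u]

/-- Gaussian decay of the theta function along a circle. -/
lemma norm_thetaC_le {ρ : ℝ} (hρ : ρ ∈ Ioo (0 : ℝ) 1) :
    ∃ c > 0, ∀ θ ∈ Icc (-π) π, ‖thetaC (ρ * Complex.exp (θ * Complex.I))‖ / jacobiH ρ ≤
      rexp (-c * θ ^ 2) := by
  have hh := one_lt_jacobiH hρ
  have hh0 : 0 < jacobiH ρ := by linarith
  have hρ0 := hρ.1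
  refine ⟨2 * ρ / (π ^ 2 * (1 + ρ)) / jacobiH ρ, by positivity, fun θ hθ => ?_⟩
  set w : ℂ := ρ * Complex.exp (θ * Complex.I) with hw
  have hwn : ‖w‖ = ρ := by simp [hw, Complex.norm_exp_ofReal_mul_I, abs_of_pos hρ0]
  have hS := hasSum_thetaC (w := w) (by rw [hwn]; exact hρ.2)
  have hSr := summable_pow_toNat_sq hρ.1.le hρ.2
  have h1 := hS.summable.sum_add_tsum_subtype_compl ({0, 1} : Finset ℤ)
  have h2 := hSr.sum_add_tsum_subtype_compl ({0, 1} : Finset ℤ)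
  rw [hS.tsum_eq] at h1
  rw [Finset.sum_pair (by norm_num)] at h1 h2
  simp only [ne_eq, OfNat.ofNat_ne_zero, not_false_eq_true, zero_pow, Int.toNat_zero, pow_zero,
    one_pow, Int.toNat_one, pow_one] at h1 h2
  have h3 : ‖∑' r : {x // x ∉ ({0, 1} : Finset ℤ)}, w ^ ((r : ℤ) ^ 2).toNat‖ ≤
      ∑' r : {x // x ∉ ({0, 1} : Finset ℤ)}, ρ ^ ((r : ℤ) ^ 2).toNat := by
    refine tsum_of_norm_bounded (hSr.subtype _).hasSum fun r => ?_
    simp [hwn]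
  have h4 := norm_one_add_mul_exp_le hρ0 (abs_le.2 hθ)
  have h5 : ‖thetaC w‖ ≤ jacobiH ρ - 2 * ρ / (π ^ 2 * (1 + ρ)) * θ ^ 2 := by
    rw [← h1]
    refine (norm_add_le _ _).trans ?_
    have : jacobiH ρ = _ := h2.symm
    linarith
  calc ‖thetaC w‖ / jacobiH ρ
      ≤ (jacobiH ρ - 2 * ρ / (π ^ 2 * (1 + ρ)) * θ ^ 2) / jacobiH ρ := by gcongr
    _ = -(2 * ρ / (π ^ 2 * (1 + ρ)) / jacobiH ρ) * θ ^ 2 + 1 := by field_simp; ring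
    _ ≤ _ := Real.add_one_le_exp _

section Moments

open MeasureTheory ProbabilityTheory Topology

lemma integrable_exp_mul_sq_count {t : ℝ} (ht : t < 0) :
    Integrable (fun r : ℤ => rexp (t * (r : ℝ) ^ 2)) Measure.count := by
  rw [integrable_count_iff]
  refine (summable_pow_toNat_sq (exp_pos t).le (Real.exp_lt_one_iff.2 ht)).congr fun r => ?_
  rw [Real.norm_of_nonneg (exp_pos _).le, ← Real.exp_nat_mul, toNat_sq_cast, mul_comm]

lemma mem_interior_integrableExpSet_sq {t : ℝ} (ht : t < 0) :
    t ∈ interior (integrableExpSet (fun r : ℤ => (r : ℝ) ^ 2) Measure.count) :=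
  interior_mono (s := Iio 0) (fun _ hs => integrable_exp_mul_sq_count hs)
    (by rwa [isOpen_Iio.interior_eq])

lemma mgf_sq_count {z : ℝ} (hz : z ∈ Ioo (0 : ℝ) 1) :
    mgf (fun r : ℤ => (r : ℝ) ^ 2) Measure.count (log z) = jacobiH z := by
  rw [mgf, integral_countable (integrable_exp_mul_sq_count (log_neg hz.1 hz.2)), jacobiH]
  refine tsum_congr fun r => ?_
  rw [measureReal_def, Measure.count_singleton, ENNReal.toReal_one, one_smul, ← toNat_sq_cast,
    mul_comm, Real.exp_nat_mul, exp_log hz.1]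

lemma lgam_eq_cgf (γ : ℝ) {z : ℝ} (hz : z ∈ Ioo (0 : ℝ) 1) :
    lgam γ z = cgf (fun r : ℤ => (r : ℝ) ^ 2) Measure.count (log z) - γ * log z := by
  rw [lgam, cgf, mgf_sq_count hz]

lemma deriv_lgam (γ : ℝ) {z : ℝ} (hz : z ∈ Ioo (0 : ℝ) 1) :
    deriv (lgam γ) z =
      (deriv (cgf (fun r : ℤ => (r : ℝ) ^ 2) Measure.count) (log z) - γ) / z := by
  have heq : lgam γ =ᶠ[𝓝 z] fun z =>
      cgf (fun r : ℤ => (r : ℝ) ^ 2) Measure.count (log z) - γ * log z := by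
    filter_upwards [isOpen_Ioo.mem_nhds hz] with y hy using lgam_eq_cgf γ hy
  have hK : HasDerivAt (cgf (fun r : ℤ => (r : ℝ) ^ 2) Measure.count)
      (deriv (cgf (fun r : ℤ => (r : ℝ) ^ 2) Measure.count) (log z)) (log z) :=
    (analyticAt_cgf (mem_interior_integrableExpSet_sq (log_neg hz.1 hz.2))).differentiableAt.hasDerivAt
  have hlog := hasDerivAt_log hz.1.ne'
  have hD : HasDerivAt (fun z => cgf (fun r : ℤ => (r : ℝ) ^ 2) Measure.count (log z) - γ * log z)
      _ z := (hK.comp z hlog).sub (hlog.const_mul γ)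
  rw [heq.deriv_eq, hD.deriv]
  ring

lemma sq_mul_deriv_deriv_lgam {γ z : ℝ} (hz : z ∈ Ioo (0 : ℝ) 1) (h0 : deriv (lgam γ) z = 0) :
    z ^ 2 * deriv (deriv (lgam γ)) z =
      iteratedDeriv 2 (cgf (fun r : ℤ => (r : ℝ) ^ 2) Measure.count) (log z) := by
  have heq : deriv (lgam γ) =ᶠ[𝓝 z] fun z =>
      (deriv (cgf (fun r : ℤ => (r : ℝ) ^ 2) Measure.count) (log z) - γ) / z := by
    filter_upwards [isOpen_Ioo.mem_nhds hz] with y hy using deriv_lgam γ hy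
  have hK : HasDerivAt (deriv (cgf (fun r : ℤ => (r : ℝ) ^ 2) Measure.count))
      (deriv (deriv (cgf (fun r : ℤ => (r : ℝ) ^ 2) Measure.count)) (log z)) (log z) :=
    (analyticAt_cgf
      (mem_interior_integrableExpSet_sq (log_neg hz.1 hz.2))).deriv.differentiableAt.hasDerivAt
  have hlog := hasDerivAt_log hz.1.ne'
  have hz0 := hz.1.ne'
  rw [deriv_lgam γ hz, div_eq_zero_iff, or_iff_left hz0] at h0
  have hD : HasDerivAt
      (fun z => (deriv (cgf (fun r : ℤ => (r : ℝ) ^ 2) Measure.count) (log z) - γ) / z) _ z :=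
    ((hK.comp z hlog).sub_const γ).div (hasDerivAt_id z) hz0
  rw [heq.deriv_eq, hD.deriv, iteratedDeriv_succ, iteratedDeriv_one]
  simp only [Function.comp, h0]
  field_simp
  ring

/-- The probability measure on `ℤ` with weights proportional to `z ^ r²`. -/
noncomputable def thetaMeasure (z : ℝ) : Measure ℤ :=
  Measure.count.tilted fun r : ℤ => log z * (r : ℝ) ^ 2

lemma isProbabilityMeasure_thetaMeasure {z : ℝ} (hz : z ∈ Ioo (0 : ℝ) 1) :
    IsProbabilityMeasure (thetaMeasure z) :=
  isProbabilityMeasure_tilted (integrable_exp_mul_sq_count (log_neg hz.1 hz.2))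

lemma charFun_thetaMeasure (γ : ℝ) {z : ℝ} (hz : z ∈ Ioo (0 : ℝ) 1) (θ : ℝ) :
    charFun ((thetaMeasure z).map fun r : ℤ => (r : ℝ) ^ 2 - γ) θ =
      Complex.exp (-(γ * θ * Complex.I)) * thetaC (z * Complex.exp (θ * Complex.I)) /
        jacobiH z := by
  rw [charFun_apply_real, integral_map (by fun_prop) (by fun_prop), thetaMeasure,
    integral_tilted_mul_eq_mgf, mgf_sq_count hz]
  have hterm : ∀ r : ℤ, (rexp (log z * (r : ℝ) ^ 2) / jacobiH z) •
      Complex.exp (θ * (((r : ℝ) ^ 2 - γ : ℝ) : ℂ) * Complex.I) =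
      Complex.exp (-(γ * θ * Complex.I)) / jacobiH z *
        (z * Complex.exp (θ * Complex.I)) ^ (r ^ 2).toNat := by
    intro r
    have hr : ((r : ℝ) : ℂ) ^ 2 = (((r ^ 2).toNat : ℕ) : ℂ) := by
      rw [← Complex.ofReal_pow, ← toNat_sq_cast, Complex.ofReal_natCast]
    rw [← toNat_sq_cast, mul_comm (log z), Real.exp_nat_mul, exp_log hz.1, mul_pow,
      ← Complex.exp_nat_mul, Complex.real_smul]
    push_cast
    rw [show (θ : ℂ) * ((((r ^ 2).toNat : ℕ) : ℂ) - γ) * Complex.I =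
      -(γ * θ * Complex.I) + ((r ^ 2).toNat : ℕ) * (θ * Complex.I) by ring, Complex.exp_add]
    ring
  have hw : ‖(z : ℂ) * Complex.exp (θ * Complex.I)‖ = z := by
    simp [Complex.norm_exp_ofReal_mul_I, abs_of_pos hz.1]
  have hS := hasSum_thetaC (hw.trans_lt hz.2)
  simp_rw [hterm]
  rw [integral_const_mul, integral_countable]
  · simp only [measureReal_def, Measure.count_singleton, ENNReal.toReal_one, one_smul, hS.tsum_eq]
    ring
  · rw [integrable_count_iff]
    simpa only [norm_pow, hw] using summable_pow_toNat_sq hz.1.le hz.2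

lemma pos_integral_sq_of_norm_charFun_lt_one {Ω : Type*} {mΩ : MeasurableSpace Ω} {P : Measure Ω}
    [IsProbabilityMeasure P] {Y : Ω → ℝ} (hY : MemLp Y 2 P) {θ : ℝ}
    (hθ : ‖charFun (P.map Y) θ‖ < 1) : 0 < ∫ ω, Y ω ^ 2 ∂P := by
  refine (integral_nonneg fun ω => sq_nonneg (Y ω)).lt_of_ne' fun h => ?_
  rw [integral_eq_zero_iff_of_nonneg (fun ω => sq_nonneg (Y ω)) hY.integrable_sq] at h
  have hY0 : Y =ᵐ[P] fun _ => 0 := by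
    filter_upwards [h] with ω hω
    simpa using hω
  rw [Measure.map_congr hY0] at hθ
  simp at hθ

end Moments

section Asymptotics

open MeasureTheory ProbabilityTheory Topology

/-- The amplitude in the Fourier integral representing `N₁ - N₂`. -/
noncomputable def amplitude (γ z θ : ℝ) : ℂ :=
  (thetaC (z * Complex.exp (θ * Complex.I)) - 1) * (1 - z * Complex.exp (θ * Complex.I))⁻¹ *
    Complex.exp (-(γ * θ * Complex.I))

lemma norm_ofReal_mul_exp {z : ℝ} (hz : 0 < z) (θ : ℝ) :
    ‖(z : ℂ) * Complex.exp (θ * Complex.I)‖ = z := by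
  simp [Complex.norm_exp_ofReal_mul_I, abs_of_pos hz]

lemma continuous_amplitude (γ : ℝ) {z : ℝ} (hz : z ∈ Ioo (0 : ℝ) 1) :
    Continuous (amplitude γ z) := by
  have hp := isProbabilityMeasure_thetaMeasure hz
  have hmap : IsProbabilityMeasure ((thetaMeasure z).map fun r : ℤ => (r : ℝ) ^ 2 - 0) :=
    Measure.isProbabilityMeasure_map (by fun_prop)
  have hh : (jacobiH z : ℂ) ≠ 0 := by
    exact_mod_cast (zero_lt_one.trans (one_lt_jacobiH hz)).ne'
  have hT : Continuous fun θ : ℝ => thetaC (z * Complex.exp (θ * Complex.I)) := by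
    have hc := (continuous_charFun (μ := (thetaMeasure z).map fun r : ℤ => (r : ℝ) ^ 2 - 0)).mul_const
      (jacobiH z : ℂ)
    refine hc.congr fun θ => ?_
    rw [charFun_thetaMeasure 0 hz]
    simp [hh]
  refine ((hT.sub continuous_const).mul (Continuous.inv₀ (by fun_prop) fun θ h => ?_)).mul
    (by fun_prop)
  have := norm_ofReal_mul_exp hz.1 θ
  rw [← sub_eq_zero.1 h, norm_one] at this
  exact hz.2.ne' this

lemma thetaC_ofReal (z : ℝ) : thetaC z = jacobiH z := by
  simp [thetaC, jacobiH, Complex.ofReal_tsum]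

lemma amplitude_zero (γ z : ℝ) :
    amplitude γ z 0 = (((jacobiH z - 1) / (1 - z) : ℝ) : ℂ) := by
  simp [amplitude, thetaC_ofReal, div_eq_mul_inv]

/-- The Fourier representation of `N₁ - N₂`. -/
lemma integral_amplitude_mul_charFun_pow {γ z : ℝ} (hz : z ∈ Ioo (0 : ℝ) 1) {n m : ℕ}
    (h : γ * ((n + 1 : ℕ) : ℝ) = m) :
    ∫ θ in (-π)..π, amplitude γ z θ *
        charFun ((thetaMeasure z).map fun r : ℤ => (r : ℝ) ^ 2 - γ) θ ^ n =
      (2 * π * z ^ m * ((N1 (n + 1) γ : ℝ) - N2 (n + 1) γ) / jacobiH z ^ n : ℝ) := by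
  have hh : (jacobiH z : ℂ) ≠ 0 := by
    exact_mod_cast (zero_lt_one.trans (one_lt_jacobiH hz)).ne'
  have hs : Summable fun x => z ^ latticeDegree n x := by
    have := (hasSum_pow_latticeDegree ((norm_ofReal_mul_exp hz.1 0).trans_lt hz.2) n).1
    rwa [norm_ofReal_mul_exp hz.1 0] at this
  have key := integral_tsum_pow_mul_exp (latticeDegree n) hz.1 hs m
  have hm : (m : ℂ) = γ * (n + 1) := by exact_mod_cast h.symm
  have hint : ∀ θ : ℝ, amplitude γ z θ *
      charFun ((thetaMeasure z).map fun r : ℤ => (r : ℝ) ^ 2 - γ) θ ^ n =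
      ((∑' x, (z * Complex.exp (θ * Complex.I)) ^ latticeDegree n x) *
        Complex.exp (-(m * θ * Complex.I))) * ((jacobiH z : ℂ) ^ n)⁻¹ := by
    intro θ
    rw [(hasSum_pow_latticeDegree ((norm_ofReal_mul_exp hz.1 θ).trans_lt hz.2) n).2.tsum_eq,
      charFun_thetaMeasure γ hz, amplitude, div_pow, mul_pow, ← Complex.exp_nat_mul,
      show -((m : ℂ) * θ * Complex.I) = -(γ * θ * Complex.I) + n * -(γ * θ * Complex.I) by
        rw [hm]; ring, Complex.exp_add]
    ring
  simp_rw [hint]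
  rw [intervalIntegral.integral_mul_const, key, N1_sub_N2_eq_ncard n m γ h]
  push_cast
  ring

lemma tendsto_sqrt_mul_fourier_integral {γ z : ℝ} (hz : z ∈ Ioo (0 : ℝ) 1)
    (h0 : deriv (lgam γ) z = 0) :
    0 < deriv (deriv (lgam γ)) z ∧
    Tendsto (fun n : ℕ => (√n : ℂ) * ∫ θ in (-π)..π, amplitude γ z θ *
        charFun ((thetaMeasure z).map fun r : ℤ => (r : ℝ) ^ 2 - γ) θ ^ n) atTop
      (𝓝 (((jacobiH z - 1) / (1 - z) * √(2 * π / (z ^ 2 * deriv (deriv (lgam γ)) z)) : ℝ) : ℂ)) := by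
  have hp := isProbabilityMeasure_thetaMeasure hz
  have hmem := mem_interior_integrableExpSet_sq (log_neg hz.1 hz.2)
  obtain ⟨c, hc, hdecay⟩ := norm_thetaC_le hz
  have hh : 0 < jacobiH z := zero_lt_one.trans (one_lt_jacobiH hz)
  have hdecay' : ∀ θ ∈ Icc (-π) π,
      ‖charFun ((thetaMeasure z).map fun r : ℤ => (r : ℝ) ^ 2 - γ) θ‖ ≤ rexp (-c * θ ^ 2) := by
    intro θ hθ
    rw [charFun_thetaMeasure γ hz, norm_div, norm_mul,
      show -((γ : ℂ) * θ * Complex.I) = ((-(γ * θ) : ℝ) : ℂ) * Complex.I by push_cast; ring,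
      Complex.norm_exp_ofReal_mul_I, one_mul, Complex.norm_real, Real.norm_of_nonneg hh.le]
    exact hdecay θ hθ
  have hLp : MemLp (fun r : ℤ => (r : ℝ) ^ 2) 2 (thetaMeasure z) := by
    have h2 := memLp_tilted_mul hmem 2
    exact h2
  have hmean : ∫ r : ℤ, (r : ℝ) ^ 2 ∂thetaMeasure z = γ := by
    have hd := deriv_lgam γ hz
    rw [h0, eq_comm, div_eq_zero_iff, or_iff_left hz.1.ne', sub_eq_zero] at hd
    rw [← hd]
    exact integral_tilted_mul_self hmem
  have hcent : ∫ r : ℤ, ((r : ℝ) ^ 2 - γ) ∂thetaMeasure z = 0 := by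
    rw [integral_sub (hLp.integrable (by norm_num)) (integrable_const _), hmean]
    simp
  have hvar : ∫ r : ℤ, ((r : ℝ) ^ 2 - γ) ^ 2 ∂thetaMeasure z =
      z ^ 2 * deriv (deriv (lgam γ)) z := by
    rw [sq_mul_deriv_deriv_lgam hz h0, ← variance_tilted_mul hmem]
    have := variance_eq_integral (μ := thetaMeasure z) (X := fun r : ℤ => (r : ℝ) ^ 2)
      (by fun_prop)
    rw [hmean] at this
    exact this.symm
  have hpos : 0 < z ^ 2 * deriv (deriv (lgam γ)) z := by
    rw [← hvar]
    refine pos_integral_sq_of_norm_charFun_lt_one (hLp.sub (memLp_const γ)) (θ := 1)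
      ((hdecay' 1 ⟨by linarith [pi_pos], by linarith [pi_gt_three]⟩).trans_lt ?_)
    simpa using hc
  refine ⟨pos_of_mul_pos_right hpos (sq_nonneg z), ?_⟩
  have hlim := tendsto_sqrt_mul_integral_charFun_pow hpos hc (by fun_prop) hcent hvar hdecay'
    (continuous_amplitude γ hz)
  rwa [amplitude_zero, ← Complex.ofReal_mul] at hlim

end Asymptotics

/-- For a positive rational `γ`, with `z_γ ∈ (0,1)` the unique root of
`l_γ'`, as `d → ∞` along integers with `γ d ∈ ℤ`,
`log(N₁(d,γ) − N₂(d,γ)) − [d l_γ(z_γ) − ½ log d − log(h(z_γ) z_γ (1−z_γ) √(2 l_γ''(z_γ) π) / (h(z_γ) − 1))] → 0`. -/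
theorem log_N1_sub_N2_asymptotics (γ : ℚ) (hγ : 0 < γ) (zγ : ℝ)
    (hzγ : zγ ∈ Set.Ioo (0 : ℝ) 1 ∧ deriv (lgam (γ : ℝ)) zγ = 0)
    (huniq : ∀ z : ℝ, z ∈ Set.Ioo (0 : ℝ) 1 ∧ deriv (lgam (γ : ℝ)) z = 0 → z = zγ) :
    Filter.Tendsto
      (fun d : ℕ =>
        Real.log ((N1 d (γ : ℝ) : ℝ) - (N2 d (γ : ℝ) : ℝ)) -
          ((d : ℝ) * lgam (γ : ℝ) zγ - (1 / 2) * Real.log d -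
            Real.log (jacobiH zγ * zγ * (1 - zγ) *
              Real.sqrt (2 * deriv (deriv (lgam (γ : ℝ))) zγ * Real.pi) /
                (jacobiH zγ - 1))))
      (alongIntMultiples γ) (nhds 0) := by
  obtain ⟨hz, h0⟩ := hzγ
  obtain ⟨hl2, hlimC⟩ := tendsto_sqrt_mul_fourier_integral hz h0
  set z := zγ
  set D := deriv (deriv (lgam (γ : ℝ))) z
  set B : ℕ → ℝ := fun n => ((√n : ℂ) * ∫ θ in (-π)..π, amplitude γ z θ *
    MeasureTheory.charFun ((thetaMeasure z).map fun r : ℤ => (r : ℝ) ^ 2 - (γ : ℝ)) θ ^ n).re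
    with hB
  set L := (jacobiH z - 1) / (1 - z) * √(2 * π / (z ^ 2 * D)) with hL
  have hz0 : 0 < z := hz.1
  have hz1 : 0 < 1 - z := sub_pos.2 hz.2
  have hh1 : 0 < jacobiH z - 1 := sub_pos.2 (one_lt_jacobiH hz)
  have hh : 0 < jacobiH z := by linarith
  have hLpos : 0 < L := by positivity
  have hBlim : Tendsto B atTop (nhds L) := by
    have hre := (Complex.continuous_re.tendsto _).comp hlimC
    rwa [Complex.ofReal_re] at hre
  have hconst : Real.log (jacobiH z * z * (1 - z) * √(2 * D * π) / (jacobiH z - 1)) =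
      Real.log (2 * π) + Real.log (jacobiH z) - Real.log L := by
    rw [← Real.log_mul (by positivity) (by positivity), ← Real.log_div (by positivity) hLpos.ne']
    congr 1
    have hsq : √(2 * D * π) * √(2 * π / (z ^ 2 * D)) = 2 * π / z := by
      rw [← Real.sqrt_mul (by positivity), show 2 * D * π * (2 * π / (z ^ 2 * D)) = (2 * π / z) ^ 2 by
        field_simp, Real.sqrt_sq (by positivity)]
    rw [eq_div_iff hLpos.ne', hL]
    calc _ = jacobiH z * z * (√(2 * D * π) * √(2 * π / (z ^ 2 * D))) := by field_simp
      _ = _ := by rw [hsq]; field_simp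
  have hpred : Tendsto (fun d : ℕ => d - 1) atTop atTop := tendsto_sub_atTop_nat 1
  have hG : Tendsto (fun d : ℕ => Real.log (B (d - 1)) - Real.log L +
      1 / 2 * (Real.log ((d - 1 : ℕ) + 1) - Real.log (d - 1 : ℕ))) atTop (nhds 0) := by
    have h1 := ((Real.continuousAt_log hLpos.ne').tendsto.comp hBlim).sub_const (Real.log L)
    have h2 := Real.tendsto_log_nat_add_one_sub_log.const_mul (1 / 2 : ℝ)
    simpa [Function.comp_def] using (h1.add h2).comp hpred
  refine (hG.mono_left inf_le_left).congr' ?_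
  refine eventually_inf_principal.2 ?_
  filter_upwards [eventually_gt_atTop 1, hpred.eventually (hBlim.eventually_const_lt hLpos)]
    with d hd hBpos hdm
  obtain ⟨n, rfl⟩ : ∃ n, d = n + 1 := ⟨d - 1, by omega⟩
  obtain ⟨m', hm'⟩ := hdm
  have hγ' : (0 : ℝ) < γ := by exact_mod_cast hγ
  have hm0 : 0 ≤ m' := by
    have : (0 : ℝ) ≤ m' := hm' ▸ by positivity
    exact_mod_cast this
  lift m' to ℕ using hm0 with m
  rw [Int.cast_natCast] at hm'
  rw [Nat.add_sub_cancel] at hBpos ⊢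
  have hn : (0 : ℝ) < n := by exact_mod_cast (by omega : 0 < n)
  set N : ℝ := (N1 (n + 1) (γ : ℝ) : ℝ) - N2 (n + 1) (γ : ℝ) with hN
  have hBn : B n = √n * (2 * π * z ^ m * N / jacobiH z ^ n) := by
    simp only [hB]
    rw [integral_amplitude_mul_charFun_pow hz hm', ← Complex.ofReal_mul, Complex.ofReal_re]
  have hNpos : 0 < N := by
    rw [hBn] at hBpos
    by_contra hneg
    have : 2 * π * z ^ m * N / jacobiH z ^ n ≤ 0 :=
      div_nonpos_of_nonpos_of_nonneg
        (mul_nonpos_of_nonneg_of_nonpos (by positivity) (not_lt.1 hneg)) (by positivity)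
    exact absurd hBpos (not_lt.2 (mul_nonpos_of_nonneg_of_nonpos (Real.sqrt_nonneg _) this))
  rw [hconst, hBn, Real.log_mul (by positivity) (by positivity), Real.log_sqrt hn.le,
    Real.log_div (by positivity) (by positivity), Real.log_mul (by positivity) hNpos.ne',
    Real.log_mul (by positivity) (by positivity), Real.log_pow, Real.log_pow, lgam, ← hm']
  push_cast
  ring
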